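/- Let f(x) = ∑_{k≥0} (1/3)_k · 3^k · x^{3k}/(3k)! and g(x) = ∑_{k≥0} (2/3)_k · 3^k · x^{3k+1}/(3k+1)! be the Airy atoms. For all real x and t, the exponential generating functions of the polynomials P_n and Q_n satisfy ∑_{n≥0} P_n(x)·t^n/n! = g'(x)·f(x+t) − f'(x)·g(x+t) and ∑_{n≥0} Q_n(x)·t^n/n! = f(x)·g(x+t) − g(x)·f(x+t), both series converging absolutely. -/

import Mathlib

open Polynomial

/-- The Airy atom `f(x) = ∑_{k≥0} (1/3)_k · 3^k · x^{3k}/(3k)!`. -/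
noncomputable def airyAtomF (x : ℝ) : ℝ :=
  ∑' k : ℕ, (ascPochhammer ℝ k).eval (1/3 : ℝ) * 3 ^ k * x ^ (3 * k) /
    (Nat.factorial (3 * k) : ℝ)

/-- The Airy atom `g(x) = ∑_{k≥0} (2/3)_k · 3^k · x^{3k+1}/(3k+1)!`. -/
noncomputable def airyAtomG (x : ℝ) : ℝ :=
  ∑' k : ℕ, (ascPochhammer ℝ k).eval (2/3 : ℝ) * 3 ^ k * x ^ (3 * k + 1) /
    (Nat.factorial (3 * k + 1) : ℝ)

/-- The pair of polynomial families `(P n, Q n)` defined by the recurrence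
`P_{n+1} = P_n' + X·Q_n`, `Q_{n+1} = P_n + Q_n'` with `P_0 = 1`, `Q_0 = 0`. -/
noncomputable def airyPQ : ℕ → Polynomial ℝ × Polynomial ℝ
  | 0 => (1, 0)
  | n + 1 =>
      ((airyPQ n).1.derivative + X * (airyPQ n).2,
       (airyPQ n).1 + (airyPQ n).2.derivative)

noncomputable def airyP (n : ℕ) : Polynomial ℝ := (airyPQ n).1
noncomputable def airyQ (n : ℕ) : Polynomial ℝ := (airyPQ n).2

/-- The exponential generating function `∑ c n * x ^ n / n!` of a real sequence. -/
noncomputable def egf (c : ℕ → ℝ) (x : ℝ) : ℝ := ∑' n : ℕ, c n * x ^ n / (n.factorial : ℝ)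

/-- A sequence whose exponential generating function converges on the whole real line. -/
def IsEntireSeq (c : ℕ → ℝ) : Prop :=
  ∀ x : ℝ, Summable fun n : ℕ => c n * x ^ n / (n.factorial : ℝ)

theorem IsEntireSeq.shift {c : ℕ → ℝ} (hc : IsEntireSeq c) :
    IsEntireSeq fun n => c (n + 1) := by
  intro x
  have h := ((summable_nat_add_iff 1).2 (hc (2 * (|x| + 1)))).norm
  refine Summable.of_norm_bounded h fun n => ?_
  have hx : 0 ≤ |x| := abs_nonneg x
  have hpow : ((n : ℝ) + 1) * |x| ^ n ≤ (2 * (|x| + 1)) ^ (n + 1) := by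
    rw [mul_pow]
    have h₁ : ((n : ℝ) + 1) ≤ 2 ^ (n + 1) := by
      exact_mod_cast (Nat.lt_two_pow_self (n := n + 1)).le
    have h₂ : |x| ^ n ≤ (|x| + 1) ^ (n + 1) :=
      (pow_le_pow_left₀ hx (by linarith) n).trans
        (pow_le_pow_right₀ (by linarith) n.le_succ)
    exact mul_le_mul h₁ h₂ (by positivity) (by positivity)
  have hfac : (0 : ℝ) < n.factorial := by exact_mod_cast n.factorial_pos
  simp only [Real.norm_eq_abs, abs_div, abs_mul, abs_pow, Nat.abs_cast, Nat.factorial_succ,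
    Nat.cast_mul, Nat.cast_add, Nat.cast_one]
  rw [abs_of_nonneg (by positivity : 0 ≤ |x| + 1), abs_of_pos (by norm_num : (0 : ℝ) < 2),
    abs_of_nonneg (by positivity : (0 : ℝ) ≤ (n : ℝ) + 1), div_le_div_iff₀ hfac (by positivity)]
  calc |c (n + 1)| * |x| ^ n * (((n : ℝ) + 1) * n.factorial)
      = |c (n + 1)| * n.factorial * (((n : ℝ) + 1) * |x| ^ n) := by ring
    _ ≤ |c (n + 1)| * n.factorial * (2 * (|x| + 1)) ^ (n + 1) := by gcongr
    _ = |c (n + 1)| * (2 * (|x| + 1)) ^ (n + 1) * n.factorial := by ring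

theorem IsEntireSeq.hasDerivAt_egf {c : ℕ → ℝ} (hc : IsEntireSeq c) (x : ℝ) :
    HasDerivAt (egf c) (egf (fun n => c (n + 1)) x) x := by
  have hx : x ∈ Metric.ball (0 : ℝ) (|x| + 1) := by simp
  have h0 : (0 : ℝ) ∈ Metric.ball (0 : ℝ) (|x| + 1) := by simp; positivity
  have hsum := hc.shift (|x| + 1)
  have hu : Summable fun n : ℕ =>
      ‖c n * ((n : ℝ) * (|x| + 1) ^ (n - 1)) / (n.factorial : ℝ)‖ := by
    refine (summable_nat_add_iff 1).1 (hsum.norm.congr fun n => ?_)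
    congr 1
    simp only [Nat.factorial_succ, Nat.add_sub_cancel, Nat.cast_mul]
    field_simp
  have key := hasDerivAt_tsum_of_isPreconnected (𝕜 := ℝ)
    (g := fun n y => c n * y ^ n / (n.factorial : ℝ))
    (g' := fun n y => c n * ((n : ℝ) * y ^ (n - 1)) / (n.factorial : ℝ)) hu
    Metric.isOpen_ball (convex_ball (0 : ℝ) (|x| + 1)).isPreconnected
    (fun n y _ => ((hasDerivAt_pow n y).const_mul (c n)).div_const _)
    (fun n y hy => ?_) h0 (hc 0) hx
  · convert! key using 1
    have hs : Summable fun n : ℕ => c n * ((n : ℝ) * x ^ (n - 1)) / (n.factorial : ℝ) := by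
      refine (summable_nat_add_iff 1).1 ((hc.shift x).congr fun n => ?_)
      simp only [Nat.factorial_succ, Nat.add_sub_cancel, Nat.cast_mul]
      field_simp
    rw [hs.tsum_eq_zero_add]
    simp only [egf, Nat.factorial_succ, Nat.add_sub_cancel, Nat.cast_mul, Nat.cast_zero, zero_mul,
      mul_zero, zero_div, zero_add]
    refine tsum_congr fun n => ?_
    field_simp
  · have hy' : |y| ≤ |x| + 1 := by simpa using (mem_ball_zero_iff.1 hy).le
    simp only [norm_div, norm_mul, norm_pow, Real.norm_eq_abs]
    rw [abs_of_nonneg (by positivity : 0 ≤ |x| + 1)]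
    gcongr

theorem IsEntireSeq.hasFPowerSeriesOnBall_egf {c : ℕ → ℝ} (hc : IsEntireSeq c) :
    HasFPowerSeriesOnBall (egf c)
      (FormalMultilinearSeries.ofScalars ℝ fun n => c n / (n.factorial : ℝ)) 0 ⊤ := by
  have hr : (FormalMultilinearSeries.ofScalars ℝ
      fun n => c n / (n.factorial : ℝ)).radius = ⊤ := by
    refine FormalMultilinearSeries.radius_eq_top_of_summable_norm _ fun r => ?_
    refine (hc r).norm.congr fun n => ?_
    simp only [FormalMultilinearSeries.ofScalars_norm, norm_div, norm_mul, norm_pow,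
      NNReal.norm_eq]
    ring
  refine ⟨hr.ge, by simp, fun {y} _ => ?_⟩
  simp only [FormalMultilinearSeries.ofScalars_apply_eq, zero_add, smul_eq_mul]
  refine (hc y).hasSum.congr_fun ?_
  intro n
  ring

/-- The Taylor series of an entire exponential generating function at any point converges to it. -/
theorem IsEntireSeq.hasSum_taylor_egf {c : ℕ → ℝ} (hc : IsEntireSeq c) (x t : ℝ) :
    HasSum (fun n : ℕ => iteratedDeriv n (egf c) x * t ^ n / (n.factorial : ℝ))
      (egf c (x + t)) := by
  have h := (hc.hasFPowerSeriesOnBall_egf.changeOrigin (y := x) (by simp)).hasSum_iteratedFDeriv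
    (y := t) (by simp)
  rw [zero_add] at h
  refine h.congr_fun ?_
  intro n
  rw [iteratedFDeriv_apply_eq_iteratedDeriv_mul_prod]
  simp only [Finset.prod_const, Finset.card_univ, Fintype.card_fin, smul_eq_mul]
  ring

/-- The recurrence satisfied by the derivatives at `0` of a solution of `y'' = x y`. -/
def IsAirySeq (c : ℕ → ℝ) : Prop :=
  c 2 = 0 ∧ ∀ n : ℕ, c (n + 3) = ((n : ℝ) + 1) * c n

theorem IsAirySeq.exists_bound {c : ℕ → ℝ} (hc : IsAirySeq c) {s : ℝ} (hs : 0 ≤ s) :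
    ∃ C : ℝ, ∀ n : ℕ, |c n| * s ^ n / (n.factorial : ℝ) ≤ C := by
  obtain ⟨N, hN⟩ := exists_nat_ge (s ^ 3)
  let d : ℕ → ℝ := fun n => |c n| * s ^ n / (n.factorial : ℝ)
  have hd : ∀ n, 0 ≤ d n := fun n => by positivity
  refine ⟨∑ i ∈ Finset.range (N + 3), d i, fun n => ?_⟩
  change d n ≤ _
  induction n using Nat.strong_induction_on with
  | _ n ih =>
    by_cases hn : n < N + 3
    · exact Finset.single_le_sum (fun i _ => hd i) (Finset.mem_range.2 hn)
    · obtain ⟨m, rfl⟩ : ∃ m, n = m + 3 := ⟨n - 3, by omega⟩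
      refine le_trans ?_ (ih m (by omega))
      have hm : (N : ℝ) ≤ m := by exact_mod_cast (by omega : N ≤ m)
      have hfac : (0 : ℝ) < m.factorial := by exact_mod_cast m.factorial_pos
      have hstep : d (m + 3) = d m * (s ^ 3 / (((m : ℝ) + 2) * ((m : ℝ) + 3))) := by
        simp only [d, hc.2 m, abs_mul, Nat.factorial_succ, Nat.cast_mul, Nat.cast_add,
          Nat.cast_one]
        rw [abs_of_nonneg (by positivity : (0 : ℝ) ≤ (m : ℝ) + 1)]
        field_simp
        ring
      rw [hstep]
      refine mul_le_of_le_one_right (hd m) ((div_le_one (by positivity)).2 ?_)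
      nlinarith [(Nat.cast_nonneg m : (0 : ℝ) ≤ m)]

theorem IsAirySeq.isEntireSeq {c : ℕ → ℝ} (hc : IsAirySeq c) : IsEntireSeq c := by
  intro x
  obtain ⟨C, hC⟩ := hc.exists_bound (s := 2 * |x|) (by positivity)
  refine Summable.of_norm_bounded (summable_geometric_two.mul_left C) fun n => ?_
  have h := hC n
  calc ‖c n * x ^ n / (n.factorial : ℝ)‖
      = |c n| * (2 * |x|) ^ n / (n.factorial : ℝ) * (1 / 2) ^ n := by
        simp only [Real.norm_eq_abs, abs_div, abs_mul, abs_pow, Nat.abs_cast]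
        rw [mul_pow, one_div, inv_pow]
        field_simp
    _ ≤ C * (1 / 2) ^ n := by gcongr

/-- `y'' = x y` for the exponential generating function of an Airy sequence. -/
theorem IsAirySeq.egf_shift_shift {c : ℕ → ℝ} (hc : IsAirySeq c) (x : ℝ) :
    egf (fun n => c (n + 2)) x = x * egf c x := by
  have hs : Summable fun n : ℕ => c (n + 2) * x ^ n / (n.factorial : ℝ) :=
    hc.isEntireSeq.shift.shift x
  rw [egf, hs.tsum_eq_zero_add, egf, ← tsum_mul_left]
  simp only [zero_add, hc.1, zero_mul, zero_div]
  refine tsum_congr fun n => ?_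
  rw [show n + 1 + 2 = n + 3 from rfl, hc.2 n]
  simp only [Nat.factorial_succ, Nat.cast_mul, Nat.cast_add, Nat.cast_one]
  field_simp
  ring

theorem IsAirySeq.iteratedDeriv_egf {c : ℕ → ℝ} (hc : IsAirySeq c) (n : ℕ) :
    iteratedDeriv n (egf c) = fun x =>
      (airyP n).eval x * egf c x + (airyQ n).eval x * egf (fun n => c (n + 1)) x := by
  induction n with
  | zero => simp [airyP, airyQ, airyPQ]
  | succ n ih =>
    funext x
    have h₁ := hc.isEntireSeq.hasDerivAt_egf x
    have h₂ := hc.isEntireSeq.shift.hasDerivAt_egf x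
    have h := (((airyP n).hasDerivAt x).mul h₁).add (((airyQ n).hasDerivAt x).mul h₂)
    rw [hc.egf_shift_shift] at h
    rw [iteratedDeriv_succ, ih]
    refine h.deriv.trans ?_
    simp only [airyP, airyQ, airyPQ, eval_add, eval_mul, eval_X]
    ring

theorem egf_zero (c : ℕ → ℝ) : egf c 0 = c 0 := by
  rw [egf, tsum_eq_single 0 fun n hn => by simp [hn]]
  simp

/-- The Wronskian of two solutions of `y'' = x y` is constant. -/
theorem IsAirySeq.wronskian_egf {a b : ℕ → ℝ} (ha : IsAirySeq a) (hb : IsAirySeq b) (x : ℝ) :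
    egf a x * egf (fun n => b (n + 1)) x - egf (fun n => a (n + 1)) x * egf b x
      = a 0 * b 1 - a 1 * b 0 := by
  have h : ∀ y : ℝ, HasDerivAt (fun y => egf a y * egf (fun n => b (n + 1)) y
      - egf (fun n => a (n + 1)) y * egf b y) 0 y := fun y => by
    have h := ((ha.isEntireSeq.hasDerivAt_egf y).mul (hb.isEntireSeq.shift.hasDerivAt_egf y)).sub
      ((ha.isEntireSeq.shift.hasDerivAt_egf y).mul (hb.isEntireSeq.hasDerivAt_egf y))
    rw [ha.egf_shift_shift, hb.egf_shift_shift] at h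
    convert! h using 1
    ring
  have h0 := is_const_of_deriv_eq_zero (fun y => (h y).differentiableAt) (fun y => (h y).deriv) x 0
  simpa only [egf_zero, zero_add] using h0

/-- The derivatives at `0` of the Airy atom whose exponents are congruent to `r` modulo `3`. -/
noncomputable def airyCoeff (r n : ℕ) : ℝ :=
  if n % 3 = r then (ascPochhammer ℝ (n / 3)).eval (((r : ℝ) + 1) / 3) * 3 ^ (n / 3) else 0

theorem isAirySeq_airyCoeff {r : ℕ} (hr : r < 2) : IsAirySeq (airyCoeff r) := by
  refine ⟨if_neg (by omega), fun n => ?_⟩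
  unfold airyCoeff
  rw [Nat.add_mod_right, Nat.add_div_right n (by norm_num)]
  split_ifs with h
  · have hn : (n : ℝ) = 3 * (n / 3 : ℕ) + r := by exact_mod_cast (by omega : n = 3 * (n / 3) + r)
    rw [ascPochhammer_succ_eval, pow_succ]
    generalize n / 3 = k at hn ⊢
    rw [hn]
    ring
  · simp

theorem egf_airyCoeff {r : ℕ} (hr : r < 2) (x : ℝ) :
    egf (airyCoeff r) x = ∑' k : ℕ, (ascPochhammer ℝ k).eval (((r : ℝ) + 1) / 3) * 3 ^ k *
      x ^ (3 * k + r) / ((3 * k + r).factorial : ℝ) := by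
  have hinj : Function.Injective fun k : ℕ => 3 * k + r := fun a b h => by
    simp only at h
    omega
  rw [egf, ← hinj.tsum_eq]
  · refine tsum_congr fun k => ?_
    rw [airyCoeff, if_pos (by omega), show (3 * k + r) / 3 = k by omega]
  · intro n hn
    have hmod : n % 3 = r := by
      by_contra h
      exact hn (by simp [airyCoeff, h])
    exact ⟨n / 3, by simp only; omega⟩

theorem airyAtomF_eq_egf : airyAtomF = egf (airyCoeff 0) := by
  funext x
  simp [airyAtomF, egf_airyCoeff]

theorem airyAtomG_eq_egf : airyAtomG = egf (airyCoeff 1) := by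
  funext x
  rw [airyAtomG, egf_airyCoeff (by norm_num)]
  norm_num

theorem airyPQ_generating_functions (x t : ℝ) :
    (Summable fun n : ℕ => (airyP n).eval x * t ^ n / (Nat.factorial n : ℝ)) ∧
    (Summable fun n : ℕ => (airyQ n).eval x * t ^ n / (Nat.factorial n : ℝ)) ∧
    (∑' n : ℕ, (airyP n).eval x * t ^ n / (Nat.factorial n : ℝ)
      = deriv airyAtomG x * airyAtomF (x + t) - deriv airyAtomF x * airyAtomG (x + t)) ∧
    (∑' n : ℕ, (airyQ n).eval x * t ^ n / (Nat.factorial n : ℝ)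
      = airyAtomF x * airyAtomG (x + t) - airyAtomG x * airyAtomF (x + t)) := by
  have hF : IsAirySeq (airyCoeff 0) := isAirySeq_airyCoeff (by norm_num)
  have hG : IsAirySeq (airyCoeff 1) := isAirySeq_airyCoeff (by norm_num)
  have hW := hF.wronskian_egf hG x
  have hF' := (hF.isEntireSeq.hasDerivAt_egf x).deriv
  have hG' := (hG.isEntireSeq.hasDerivAt_egf x).deriv
  have hTF := hF.isEntireSeq.hasSum_taylor_egf x t
  have hTG := hG.isEntireSeq.hasSum_taylor_egf x t
  simp only [hF.iteratedDeriv_egf] at hTF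
  simp only [hG.iteratedDeriv_egf] at hTG
  rw [show airyCoeff 0 0 * airyCoeff 1 1 - airyCoeff 0 1 * airyCoeff 1 0 = 1 by
    simp [airyCoeff]] at hW
  rw [airyAtomF_eq_egf, airyAtomG_eq_egf, hF', hG']
  have hP := (hTF.mul_left (egf (fun n => airyCoeff 1 (n + 1)) x)).sub
    (hTG.mul_left (egf (fun n => airyCoeff 0 (n + 1)) x))
  have hQ := (hTG.mul_left (egf (airyCoeff 0) x)).sub (hTF.mul_left (egf (airyCoeff 1) x))
  replace hP := hP.congr_fun (g := fun n : ℕ => (airyP n).eval x * t ^ n / (n.factorial : ℝ))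
    fun n => by linear_combination (-(airyP n).eval x * t ^ n / (n.factorial : ℝ)) * hW
  replace hQ := hQ.congr_fun (g := fun n : ℕ => (airyQ n).eval x * t ^ n / (n.factorial : ℝ))
    fun n => by linear_combination (-(airyQ n).eval x * t ^ n / (n.factorial : ℝ)) * hW
  exact ⟨hP.summable, hQ.summable, hP.tsum_eq, hQ.tsum_eq⟩
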